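/- arXiv:math/0301003 — 2 statements merged into one kernel-verified Lean document; each statement's English description precedes it below -/
import Mathlib

section
/- Let τ be a painted stable S-tree and σ a painted stable 2-partition of S. Then exactly one of the following three alternatives holds: (i) σ = σ_e for some edge e of τ (σ breaks τ at an edge); (ii) σ ∉ {σ_e : e ∈ E_τ} and {σ_e : e ∈ E_τ} ∪ {σ} is a good family (σ breaks τ at a vertex); (iii) there exists an edge e of τ with δ(σ, σ_e) = 2 (σ does not break τ). -/
open scoped Classical
noncomputable section

namespace EMO

/-- `σ` is an unordered 2-partition of the set `X`: two distinct nonempty disjoint parts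
whose union is `X`. -/
def IsTwoPartitionOn {γ : Type*} (X : Set γ) (σ : Set (Set γ)) : Prop :=
  ∃ A B : Set γ, σ = {A, B} ∧ A ≠ B ∧ A.Nonempty ∧ B.Nonempty ∧ Disjoint A B ∧ A ∪ B = X

/-- unordered 2-partition of the whole set. -/
def IsTwoPartition {γ : Type*} (σ : Set (Set γ)) : Prop :=
  IsTwoPartitionOn Set.univ σ

/-- `δ(σ,τ)`: the number of nonempty pairwise distinct sets among the intersections
`A ∩ B`, `A ∈ σ`, `B ∈ τ`, minus 2. -/
def delta {γ : Type*} (σ τ : Set (Set γ)) : ℤ :=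
  ({C : Set γ | C.Nonempty ∧ ∃ A ∈ σ, ∃ B ∈ τ, C = A ∩ B}.ncard : ℤ) - 2

/-- `a b σ c d` : the elements `a,b` lie in one part of `σ` and `c,d` in the other. -/
def SplitsPair {γ : Type*} (σ : Set (Set γ)) (a b c d : γ) : Prop :=
  ∃ A ∈ σ, ∃ B ∈ σ, A ≠ B ∧ a ∈ A ∧ b ∈ A ∧ c ∈ B ∧ d ∈ B

/-- a painted stable 2-partition w.r.t. the set `W` of white elements: each part
contains a white element and has at least two elements. -/
def PaintedStablePart {γ : Type*} (W : Set γ) (σ : Set (Set γ)) : Prop :=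
  IsTwoPartition σ ∧ ∀ A ∈ σ, (A ∩ W).Nonempty ∧ 2 ≤ A.ncard

/-- a good family of painted stable 2-partitions: pairwise `δ = 1`. -/
def GoodFamily {γ : Type*} (W : Set γ) (E : Set (Set (Set γ))) : Prop :=
  (∀ σ ∈ E, PaintedStablePart W σ) ∧ ∀ σ ∈ E, ∀ σ' ∈ E, σ ≠ σ' → delta σ σ' = 1

/-- an allowed quadruple: pairwise distinct, and each of the pairs
`{i,j}`, `{k,l}`, `{k,j}`, `{i,l}` contains a white element. -/
def Allowed {γ : Type*} (W : Set γ) (i j k l : γ) : Prop :=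
  i ≠ j ∧ i ≠ k ∧ i ≠ l ∧ j ≠ k ∧ j ≠ l ∧ k ≠ l ∧
  (i ∈ W ∨ j ∈ W) ∧ (k ∈ W ∨ l ∈ W) ∧ (k ∈ W ∨ j ∈ W) ∧ (i ∈ W ∨ l ∈ W)

/-- `ε(σ; i,j,k,l)`. -/
def eps {γ : Type*} (σ : Set (Set γ)) (i j k l : γ) : ℤ :=
  if SplitsPair σ i j k l then 1 else if SplitsPair σ k j i l then -1 else 0

/-- A tree whose tails are bijectively labeled by `γ`: a finite graph
(vertices, flags, incidence map, involution) whose geometric realization is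
connected and simply connected (edge count), together with a labeling of the tails. -/
structure LTree (γ : Type) where
  V : Type
  Fl : Type
  [finV : Finite V]
  [finF : Finite Fl]
  bd : Fl → V
  inv : Fl → Fl
  inv_inv : ∀ f, inv (inv f) = f
  label : γ → Fl
  label_fixed : ∀ s, inv (label s) = label s
  label_inj : Function.Injective label
  label_surj : ∀ f, inv f = f → ∃ s, label s = f
  conn : ∀ v w : V, Relation.ReflTransGen (fun a b => ∃ f, bd f = a ∧ bd (inv f) = b) v w
  tree_count : Nat.card {f : Fl // inv f ≠ f} + 2 = 2 * Nat.card V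

attribute [instance] LTree.finV LTree.finF

namespace LTree

variable {γ : Type} (τ : LTree γ)

/-- flags incident to a vertex. -/
def flagsAt (v : τ.V) : Set τ.Fl := {f | τ.bd f = v}

/-- adjacency avoiding the edge `{f, inv f}`. -/
def sideAdj (f : τ.Fl) (a b : τ.V) : Prop :=
  ∃ g, g ≠ f ∧ g ≠ τ.inv f ∧ τ.bd g = a ∧ τ.bd (τ.inv g) = b

/-- labels lying on the `f`-side of the edge `{f, inv f}`. -/
def flagSide (f : τ.Fl) : Set γ :=
  {s | Relation.ReflTransGen (τ.sideAdj f) (τ.bd (τ.label s)) (τ.bd f)}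

/-- the 2-partition `σ_e` of the labels determined by the edge `{f, inv f}`. -/
def flagPartition (f : τ.Fl) : Set (Set γ) := {τ.flagSide f, τ.flagSide (τ.inv f)}

/-- the family of 2-partitions of labels determined by the edges of `τ`. -/
def edgeFamily : Set (Set (Set γ)) := {σ | ∃ f, τ.inv f ≠ f ∧ τ.flagPartition f = σ}

/-- painted stability: every vertex carries at least three flags, and every
end vertex carries a white tail. -/
def PaintedStable (W : Set γ) : Prop :=
  (∀ v : τ.V, 3 ≤ Nat.card {f : τ.Fl // τ.bd f = v}) ∧
  (∀ v : τ.V, Nat.card {f : τ.Fl // τ.bd f = v ∧ τ.inv f ≠ f} ≤ 1 →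
    ∃ s ∈ W, τ.bd (τ.label s) = v)

/-- adjacency avoiding the vertex `v`. -/
def avoidAdj (v : τ.V) (a b : τ.V) : Prop :=
  a ≠ v ∧ b ≠ v ∧ ∃ g, τ.bd g = a ∧ τ.bd (τ.inv g) = b

/-- the labels carried by the branch of `τ` at `v` starting with the flag `φ`. -/
def branchLabels (v : τ.V) (φ : τ.Fl) : Set γ :=
  {s | τ.label s = φ ∨
    (τ.inv φ ≠ φ ∧ Relation.ReflTransGen (τ.avoidAdj v) (τ.bd (τ.inv φ)) (τ.bd (τ.label s)))}

/-- the 2-partition of labels induced by a 2-partition `α` of the flags at `v`. -/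
def inducedSPart (v : τ.V) (α : Set (Set τ.Fl)) : Set (Set γ) :=
  (fun A => ⋃ φ ∈ A, τ.branchLabels v φ) '' α

/-- painted stable 2-partitions of the set of flags at `v`. -/
def VertexParts (W : Set γ) (v : τ.V) : Set (Set (Set τ.Fl)) :=
  {α | IsTwoPartitionOn (τ.flagsAt v) α ∧ PaintedStablePart W (τ.inducedSPart v α)}

/-- an allowed quadruple of (pairwise distinct) flags at the vertex `v`: there are
labels on the corresponding branches forming an allowed quadruple. -/
def AllowedFlags (W : Set γ) (v : τ.V) (I J K L : τ.Fl) : Prop :=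
  I ∈ τ.flagsAt v ∧ J ∈ τ.flagsAt v ∧ K ∈ τ.flagsAt v ∧ L ∈ τ.flagsAt v ∧
  I ≠ J ∧ I ≠ K ∧ I ≠ L ∧ J ≠ K ∧ J ≠ L ∧ K ≠ L ∧
  ∃ i ∈ τ.branchLabels v I, ∃ j ∈ τ.branchLabels v J,
    ∃ a ∈ τ.branchLabels v K, ∃ b ∈ τ.branchLabels v L, Allowed W i j a b

end LTree

/-- an `S`-isomorphism of labeled trees (flags mapped in the reverse direction). -/
structure SIso {γ : Type} (τ τ' : LTree γ) where
  vmap : τ.V ≃ τ'.V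
  fmap : τ'.Fl ≃ τ.Fl
  bd_comp : ∀ f : τ'.Fl, τ'.bd f = vmap (τ.bd (fmap f))
  inv_comp : ∀ f : τ'.Fl, fmap (τ'.inv f) = τ.inv (fmap f)
  label_comp : ∀ s : γ, fmap (τ'.label s) = τ.label s

/-- a morphism `τ' → τ` of labeled trees contracting the edge `{e₁, inv e₁}` of `τ'`. -/
structure Contraction {γ : Type} (τ' τ : LTree γ) (e₁ : τ'.Fl) where
  cF : τ.Fl → τ'.Fl
  cV : τ'.V → τ.V
  cF_inj : Function.Injective cF
  cF_range : Set.range cF = {f : τ'.Fl | f ≠ e₁ ∧ f ≠ τ'.inv e₁}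
  cF_inv : ∀ f, cF (τ.inv f) = τ'.inv (cF f)
  cF_label : ∀ s : γ, cF (τ.label s) = τ'.label s
  cV_surj : Function.Surjective cV
  cV_bd : ∀ f : τ.Fl, cV (τ'.bd (cF f)) = τ.bd f
  cV_glue : cV (τ'.bd e₁) = cV (τ'.bd (τ'.inv e₁))
  cV_almost_inj : ∀ v w : τ'.V, cV v = cV w →
    v = w ∨ (({v, w} : Set τ'.V) = {τ'.bd e₁, τ'.bd (τ'.inv e₁)})

/-- the polynomial ring `R_S = k[l_σ]` on variables indexed by painted stable
2-partitions. -/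
abbrev PSP (γ : Type) (W : Set γ) := {σ : Set (Set γ) // PaintedStablePart W σ}

abbrev Rring (γ : Type) (W : Set γ) (k : Type) [CommRing k] := MvPolynomial (PSP γ W) k

/-- the variable `l_σ` (or `0` if `σ` is not painted stable). -/
def lvar (γ : Type) (W : Set γ) (k : Type) [CommRing k] (σ : Set (Set γ)) : Rring γ W k :=
  if h : PaintedStablePart W σ then MvPolynomial.X ⟨σ, h⟩ else 0

/-- the element `R_{ijkl} = Σ_σ ε(σ; i,j,k,l) l_σ`. -/
def Rquad (γ : Type) (W : Set γ) (k : Type) [CommRing k] (i j a b : γ) : Rring γ W k :=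
  ∑ᶠ σ : PSP γ W, eps σ.1 i j a b • MvPolynomial.X σ

/-- the ideal `I_S` generated by the `R_{ijkl}` (over allowed quadruples) and the
products `l_σ l_σ'` for crossing pairs `σ, σ'`. -/
def idealI (γ : Type) (W : Set γ) (k : Type) [CommRing k] : Ideal (Rring γ W k) :=
  Ideal.span
    ({p | ∃ i j a b : γ, Allowed W i j a b ∧ p = Rquad γ W k i j a b} ∪
     {p | ∃ σ σ' : PSP γ W, (∃ i j a b : γ, Allowed W i j a b ∧
        SplitsPair σ.1 i j a b ∧ SplitsPair σ'.1 a j i b) ∧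
        p = MvPolynomial.X σ * MvPolynomial.X σ'})

/-- the good monomial `∏_{σ ∈ E} l_σ` of a family `E` of 2-partitions. -/
def mFam (γ : Type) (W : Set γ) (k : Type) [CommRing k] (E : Set (Set (Set γ))) :
    Rring γ W k :=
  ∏ᶠ σ ∈ E, lvar γ W k σ

/-- the combinatorial cohomology ring `H*_S = R_S/I_S`. -/
abbrev HS (γ : Type) (W : Set γ) (k : Type) [CommRing k] := Rring γ W k ⧸ idealI γ W k

/-- good families of painted stable 2-partitions (= iso classes of painted stable trees). -/
abbrev GoodFam (γ : Type) (W : Set γ) := {E : Set (Set (Set γ)) // GoodFamily W E}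

/-- the free `k`-module `M_S` on the iso classes `μ(τ)` of painted stable `S`-trees,
encoded by their families of edge 2-partitions. -/
abbrev MS (γ : Type) (W : Set γ) (k : Type) [CommRing k] := GoodFam γ W →₀ k

/-- the basis element `μ(τ)` of `M_S` attached to the edge family `E` of `τ`. -/
def muE (γ : Type) (W : Set γ) (k : Type) [CommRing k] (E : Set (Set (Set γ))) : MS γ W k :=
  if h : GoodFamily W E then Finsupp.single ⟨E, h⟩ 1 else 0

/-- the standard relation `r(τ, v; I,J,K,L) = Σ_α ε(α; I,J,K,L) μ(τ(α))`. -/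
def stdRelH (γ : Type) (W : Set γ) (k : Type) [CommRing k]
    (τ : LTree γ) (v : τ.V) (I J K L : τ.Fl) : MS γ W k :=
  ∑ᶠ α ∈ τ.VertexParts W v, eps α I J K L • muE γ W k (τ.edgeFamily ∪ {τ.inducedSPart v α})

/-- the span `J_S` of the standard relations. -/
def JS (γ : Type) (W : Set γ) (k : Type) [CommRing k] : Submodule k (MS γ W k) :=
  Submodule.span k {x | ∃ τ : LTree γ, τ.PaintedStable W ∧ ∃ (v : τ.V) (I J K L : τ.Fl),
    τ.AllowedFlags W v I J K L ∧ x = stdRelH γ W k τ v I J K L}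

/-- the combinatorial homology `H_{*S} = M_S/J_S`. -/
abbrev HsLow (γ : Type) (W : Set γ) (k : Type) [CommRing k] := MS γ W k ⧸ JS γ W k

end EMO

namespace EMO

section TwoPartition

variable {γ : Type*} {σ τ : Set (Set γ)}

theorem IsTwoPartition.eq_pair_compl (h : IsTwoPartition σ) {A : Set γ} (hA : A ∈ σ) :
    σ = {A, Aᶜ} ∧ A.Nonempty ∧ Aᶜ.Nonempty := by
  obtain ⟨B, C, rfl, -, hB, hC, hd, hu⟩ := h
  have hc : IsCompl B C := ⟨hd, codisjoint_iff.2 hu⟩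
  rcases hA with rfl | rfl
  · rw [hc.compl_eq]
    exact ⟨rfl, hB, hC⟩
  · rw [hc.symm.compl_eq]
    exact ⟨Set.pair_comm _ _, hC, hB⟩

theorem IsTwoPartition.exists_mem (h : IsTwoPartition σ) : ∃ A, A ∈ σ := by
  obtain ⟨A, B, rfl, -⟩ := h
  exact ⟨A, Or.inl rfl⟩

theorem isTwoPartition_pair {A B : Set γ} (hA : A.Nonempty) (hB : B.Nonempty)
    (hd : Disjoint A B) (hu : A ∪ B = Set.univ) : IsTwoPartition {A, B} :=
  ⟨A, B, rfl, fun h => hA.ne_empty (disjoint_self.1 (h ▸ hd)), hA, hB, hd, hu⟩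

theorem delta_comm (σ τ : Set (Set γ)) : delta σ τ = delta τ σ := by
  unfold delta
  congr 3
  ext C
  constructor
  all_goals
    rintro ⟨hC, A, hA, B, hB, rfl⟩
    exact ⟨hC, B, hB, A, hA, Set.inter_comm _ _⟩

theorem delta_self_le (h : IsTwoPartition σ) : delta σ σ ≤ 0 := by
  obtain ⟨A, hA⟩ := h.exists_mem
  obtain ⟨rfl, -, -⟩ := h.eq_pair_compl hA
  have hsub : {C : Set γ | C.Nonempty ∧ ∃ D ∈ ({A, Aᶜ} : Set (Set γ)),
      ∃ B ∈ ({A, Aᶜ} : Set (Set γ)), C = D ∩ B} ⊆ {A, Aᶜ} := by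
    rintro C ⟨hC, D, rfl | rfl, B, rfl | rfl, rfl⟩ <;> simp_all
  have h1 := Set.ncard_le_ncard hsub
  have h2 := Set.ncard_insert_le A {Aᶜ}
  rw [Set.ncard_singleton] at h2
  unfold delta
  omega

/-- Distinct 2-partitions having two disjoint parts satisfy `δ = 1`. -/
theorem delta_eq_one_of_inter_eq_empty (hσ : IsTwoPartition σ) (hτ : IsTwoPartition τ)
    (hne : σ ≠ τ) {A C : Set γ} (hA : A ∈ σ) (hC : C ∈ τ) (h : A ∩ C = ∅) :
    delta σ τ = 1 := by
  obtain ⟨rfl, ⟨a, ha⟩, -⟩ := hσ.eq_pair_compl hA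
  obtain ⟨rfl, ⟨c, hc⟩, -⟩ := hτ.eq_pair_compl hC
  have hAC : ∀ x, x ∈ A → x ∉ C := fun x hx hx' => Set.notMem_empty x (h ▸ ⟨hx, hx'⟩)
  obtain ⟨b, hbA, hbC⟩ : ∃ b, b ∉ A ∧ b ∉ C := by
    by_contra! hall
    have : C = Aᶜ := Set.ext fun x => ⟨fun hx hx' => hAC x hx' hx, hall x⟩
    subst this
    exact hne (by rw [compl_compl, Set.pair_comm])
  have hset : {E : Set γ | E.Nonempty ∧ ∃ D ∈ ({A, Aᶜ} : Set (Set γ)),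
      ∃ B ∈ ({C, Cᶜ} : Set (Set γ)), E = D ∩ B} = {A, C, Aᶜ ∩ Cᶜ} := by
    have h1 : A ∩ Cᶜ = A := Set.inter_eq_left.2 hAC
    have h2 : Aᶜ ∩ C = C := Set.inter_eq_right.2 fun x hx hx' => hAC x hx' hx
    ext E
    constructor
    · rintro ⟨hE, D, rfl | rfl, B, rfl | rfl, rfl⟩ <;> simp_all
    · rintro (rfl | rfl | rfl)
      · exact ⟨⟨a, ha⟩, E, by simp, Cᶜ, by simp, h1.symm⟩
      · exact ⟨⟨c, hc⟩, Aᶜ, by simp, E, by simp, h2.symm⟩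
      · exact ⟨⟨b, hbA, hbC⟩, Aᶜ, by simp, Cᶜ, by simp, rfl⟩
  have hcard : ({A, C, Aᶜ ∩ Cᶜ} : Set (Set γ)).ncard = 3 := by
    refine Set.ncard_eq_three.2 ⟨A, C, Aᶜ ∩ Cᶜ, ?_, ?_, ?_, rfl⟩
    · rintro rfl
      exact hAC a ha ha
    · intro h'
      exact (h' ▸ ha : a ∈ Aᶜ ∩ Cᶜ).1 ha
    · intro h'
      exact (h' ▸ hc : c ∈ Aᶜ ∩ Cᶜ).2 hc
  unfold delta
  rw [hset, hcard]
  norm_num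

/-- Two 2-partitions all of whose parts meet satisfy `δ = 2`. -/
theorem delta_eq_two_of_inter_nonempty (hσ : IsTwoPartition σ) (hτ : IsTwoPartition τ)
    (h : ∀ A ∈ σ, ∀ C ∈ τ, (A ∩ C).Nonempty) : delta σ τ = 2 := by
  obtain ⟨A, hA⟩ := hσ.exists_mem
  obtain ⟨C, hC⟩ := hτ.exists_mem
  obtain ⟨rfl, -, -⟩ := hσ.eq_pair_compl hA
  obtain ⟨rfl, -, -⟩ := hτ.eq_pair_compl hC
  obtain ⟨a, ha1, ha2⟩ := h A (by simp) C (by simp)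
  obtain ⟨b, hb1, hb2⟩ := h A (by simp) Cᶜ (by simp)
  obtain ⟨c, hc1, hc2⟩ := h Aᶜ (by simp) C (by simp)
  obtain ⟨d, hd1, hd2⟩ := h Aᶜ (by simp) Cᶜ (by simp)
  have hset : {E : Set γ | E.Nonempty ∧ ∃ D ∈ ({A, Aᶜ} : Set (Set γ)),
      ∃ B ∈ ({C, Cᶜ} : Set (Set γ)), E = D ∩ B} =
      insert (A ∩ C) {A ∩ Cᶜ, Aᶜ ∩ C, Aᶜ ∩ Cᶜ} := by
    ext E
    constructor
    · rintro ⟨hE, D, rfl | rfl, B, rfl | rfl, rfl⟩ <;> simp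
    · rintro (rfl | rfl | rfl | rfl)
      · exact ⟨⟨a, ha1, ha2⟩, A, by simp, C, by simp, rfl⟩
      · exact ⟨⟨b, hb1, hb2⟩, A, by simp, Cᶜ, by simp, rfl⟩
      · exact ⟨⟨c, hc1, hc2⟩, Aᶜ, by simp, C, by simp, rfl⟩
      · exact ⟨⟨d, hd1, hd2⟩, Aᶜ, by simp, Cᶜ, by simp, rfl⟩
  have hcard : ({A ∩ Cᶜ, Aᶜ ∩ C, Aᶜ ∩ Cᶜ} : Set (Set γ)).ncard = 3 := by
    refine Set.ncard_eq_three.2 ⟨_, _, _, ?_, ?_, ?_, rfl⟩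
    · intro h'
      exact (h' ▸ ⟨hb1, hb2⟩ : b ∈ Aᶜ ∩ C).1 hb1
    · intro h'
      exact (h' ▸ ⟨hb1, hb2⟩ : b ∈ Aᶜ ∩ Cᶜ).1 hb1
    · intro h'
      exact (h' ▸ ⟨hc1, hc2⟩ : c ∈ Aᶜ ∩ Cᶜ).2 hc2
  have hnot : A ∩ C ∉ ({A ∩ Cᶜ, Aᶜ ∩ C, Aᶜ ∩ Cᶜ} : Set (Set γ)) := by
    rintro (h' | h' | h')
    · exact (h' ▸ ⟨ha1, ha2⟩ : a ∈ A ∩ Cᶜ).2 ha2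
    · exact (h' ▸ ⟨ha1, ha2⟩ : a ∈ Aᶜ ∩ C).1 ha1
    · exact (h' ▸ ⟨ha1, ha2⟩ : a ∈ Aᶜ ∩ Cᶜ).1 ha1
  unfold delta
  rw [hset, Set.ncard_insert_of_notMem hnot, hcard]
  norm_num

theorem delta_eq_one_or_two (hσ : IsTwoPartition σ) (hτ : IsTwoPartition τ) (hne : σ ≠ τ) :
    delta σ τ = 1 ∨ delta σ τ = 2 := by
  by_cases h : ∃ A ∈ σ, ∃ C ∈ τ, A ∩ C = ∅
  · obtain ⟨A, hA, C, hC, h⟩ := h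
    exact Or.inl (delta_eq_one_of_inter_eq_empty hσ hτ hne hA hC h)
  · refine Or.inr (delta_eq_two_of_inter_nonempty hσ hτ fun A hA C hC => ?_)
    exact Set.nonempty_iff_ne_empty.2 fun h' => h ⟨A, hA, C, hC, h'⟩

end TwoPartition

namespace LTree

variable {γ : Type} (τ : LTree γ)

theorem inv_ne_inv {f : τ.Fl} (hf : τ.inv f ≠ f) : τ.inv (τ.inv f) ≠ τ.inv f := by
  rw [τ.inv_inv]
  exact hf.symm

theorem sideAdj_inv (f : τ.Fl) : τ.sideAdj (τ.inv f) = τ.sideAdj f := by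
  ext a b
  simp only [sideAdj, τ.inv_inv]
  constructor
  all_goals
    rintro ⟨g, h1, h2, h3⟩
    exact ⟨g, h2, h1, h3⟩

theorem sideAdj_symm (f : τ.Fl) {a b : τ.V} (h : τ.sideAdj f a b) : τ.sideAdj f b a := by
  obtain ⟨g, h1, h2, h3, h4⟩ := h
  refine ⟨τ.inv g, fun h => h2 ?_, fun h => h1 ?_, h4, by rw [τ.inv_inv, h3]⟩
  · rw [← h, τ.inv_inv]
  · rw [← τ.inv_inv g, h, τ.inv_inv]

/-- Vertices lying on the `f`-side of the edge `{f, inv f}`. -/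
def vertexSide (f : τ.Fl) : Set τ.V :=
  {v | Relation.ReflTransGen (τ.sideAdj f) v (τ.bd f)}

theorem bd_mem_vertexSide (f : τ.Fl) : τ.bd f ∈ τ.vertexSide f :=
  Relation.ReflTransGen.refl

theorem mem_flagSide {f : τ.Fl} {s : γ} :
    s ∈ τ.flagSide f ↔ τ.bd (τ.label s) ∈ τ.vertexSide f :=
  Iff.rfl

theorem bd_inv_mem_vertexSide {f g : τ.Fl} (h1 : g ≠ f) (h2 : g ≠ τ.inv f)
    (h : τ.bd g ∈ τ.vertexSide f) : τ.bd (τ.inv g) ∈ τ.vertexSide f :=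
  Relation.ReflTransGen.head (τ.sideAdj_symm f ⟨g, h1, h2, rfl, rfl⟩) h

theorem mem_vertexSide_or (f : τ.Fl) (v : τ.V) :
    v ∈ τ.vertexSide f ∨ v ∈ τ.vertexSide (τ.inv f) := by
  induction τ.conn v (τ.bd f) using Relation.ReflTransGen.head_induction_on with
  | refl => exact Or.inl (τ.bd_mem_vertexSide f)
  | head h _ ih =>
    obtain ⟨g, rfl, rfl⟩ := h
    by_cases h1 : g = f
    · subst h1
      exact Or.inl (τ.bd_mem_vertexSide g)
    by_cases h2 : g = τ.inv f
    · subst h2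
      exact Or.inr (τ.bd_mem_vertexSide _)
    refine ih.imp (Relation.ReflTransGen.head ⟨g, h1, h2, rfl, rfl⟩)
      (Relation.ReflTransGen.head ⟨g, h2, ?_, rfl, rfl⟩)
    rwa [τ.inv_inv]

/-- Removing an edge of a tree disconnects its two ends. -/
theorem not_reflTransGen_sideAdj {f : τ.Fl} (hf : τ.inv f ≠ f) :
    ¬ Relation.ReflTransGen (τ.sideAdj f) (τ.bd f) (τ.bd (τ.inv f)) := by
  intro hcyc
  have hall : ∀ v, Relation.ReflTransGen (τ.sideAdj f) v (τ.bd (τ.inv f)) := by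
    intro v
    rcases τ.mem_vertexSide_or f v with h | h
    · exact Relation.ReflTransGen.trans h hcyc
    · rw [vertexSide, sideAdj_inv] at h
      exact h
  let _ := Fintype.ofFinite τ.V
  let _ := Fintype.ofFinite τ.Fl
  let G := SimpleGraph.fromRel (τ.sideAdj f)
  have hreach : ∀ v, G.Reachable v (τ.bd (τ.inv f)) := by
    intro v
    induction hall v using Relation.ReflTransGen.head_induction_on with
    | refl => exact SimpleGraph.Reachable.refl _
    | @head a b h _ ih =>
      by_cases hab : a = b
      · exact hab ▸ ih
      · exact (SimpleGraph.Adj.reachable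
          ((SimpleGraph.fromRel_adj _ _ _).2 ⟨hab, Or.inl h⟩)).trans ih
  have hconn : G.Connected :=
    { preconnected := fun v w => (hreach v).trans (hreach w).symm
      nonempty := ⟨τ.bd f⟩ }
  have h1 := hconn.card_vert_le_card_edgeSet_add_one
  have h2 := G.dart_card_eq_twice_card_edges
  have hdart : ∀ d : G.Dart, ∃ g, g ≠ f ∧ g ≠ τ.inv f ∧ τ.bd g = d.fst ∧ τ.bd (τ.inv g) = d.snd := by
    intro d
    obtain ⟨-, h | h⟩ := (SimpleGraph.fromRel_adj _ _ _).1 d.adj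
    · exact h
    · exact τ.sideAdj_symm f h
  choose F hF1 hF2 hF3 hF4 using hdart
  have hFinj : Function.Injective F := fun d e h =>
    SimpleGraph.Dart.ext _ _ (Prod.ext (by rw [← hF3, h, hF3]) (by rw [← hF4, h, hF4]))
  have hrange : Set.range F ⊆ {g | τ.inv g ≠ g} \ {f, τ.inv f} := by
    rintro _ ⟨d, rfl⟩
    refine ⟨fun h => d.adj.ne ?_, ?_⟩
    · rw [← hF3, ← hF4, h]
    · rintro (h | h)
      exacts [hF1 d h, hF2 d h]
  have h3 := Set.ncard_le_ncard hrange
  have hpair : ({f, τ.inv f} : Set τ.Fl) ⊆ {g | τ.inv g ≠ g} := by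
    rintro g (rfl | rfl)
    exacts [hf, τ.inv_ne_inv hf]
  have h4 := Set.ncard_sdiff_add_ncard_of_subset hpair
  rw [Set.ncard_pair hf.symm] at h4
  have h5 : (Set.range F).ncard = Fintype.card G.Dart := by
    rw [← Set.image_univ, Set.ncard_image_of_injective _ hFinj, Set.ncard_univ,
      Nat.card_eq_fintype_card]
  have h6 := τ.tree_count
  have h7 : Nat.card {g : τ.Fl // τ.inv g ≠ g} = {g | τ.inv g ≠ g}.ncard := rfl
  have h8 : Nat.card G.edgeSet = G.edgeFinset.card := by
    rw [Nat.card_eq_fintype_card, SimpleGraph.edgeFinset_card]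
  omega

theorem disjoint_vertexSide {f : τ.Fl} (hf : τ.inv f ≠ f) :
    Disjoint (τ.vertexSide f) (τ.vertexSide (τ.inv f)) := by
  refine Set.disjoint_left.2 fun v h1 h2 => τ.not_reflTransGen_sideAdj hf ?_
  rw [vertexSide, sideAdj_inv] at h2
  have : Std.Symm (τ.sideAdj f) := ⟨fun _ _ => τ.sideAdj_symm f⟩
  exact (Std.Symm.symm _ _ h1).trans h2

/-- If the edge of `g` lies on the `f`-side and the edge of `f` on the `g`-side, then the
far side of `f` is contained in the `g`-side. -/
theorem vertexSide_inv_subset {f g : τ.Fl} (hf : τ.inv f ≠ f)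
    (h1 : τ.bd g ∈ τ.vertexSide f) (h2 : τ.bd (τ.inv g) ∈ τ.vertexSide f)
    (h3 : τ.bd (τ.inv f) ∈ τ.vertexSide g) : τ.vertexSide (τ.inv f) ⊆ τ.vertexSide g := by
  intro v hv
  induction hv using Relation.ReflTransGen.head_induction_on with
  | refl => exact h3
  | @head a b h hb ih =>
    have ha : a ∈ τ.vertexSide (τ.inv f) := Relation.ReflTransGen.head h hb
    obtain ⟨k, -, -, rfl, rfl⟩ := h
    refine Relation.ReflTransGen.head ⟨k, ?_, ?_, rfl, rfl⟩ ih
    · rintro rfl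
      exact Set.disjoint_left.1 (τ.disjoint_vertexSide hf) h1 ha
    · rintro rfl
      exact Set.disjoint_left.1 (τ.disjoint_vertexSide hf) h2 ha

theorem flagPartition_inv (f : τ.Fl) : τ.flagPartition (τ.inv f) = τ.flagPartition f := by
  rw [flagPartition, flagPartition, τ.inv_inv, Set.pair_comm]

/-- Two edges of a tree have equal partitions or partitions with two disjoint parts. -/
theorem flagPartition_eq_or_inter_eq_empty {f g : τ.Fl} (hf : τ.inv f ≠ f) (hg : τ.inv g ≠ g) :
    τ.flagPartition f = τ.flagPartition g ∨
      ∃ A ∈ τ.flagPartition f, ∃ C ∈ τ.flagPartition g, A ∩ C = ∅ := by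
  by_cases h1 : g = f
  · exact Or.inl (h1 ▸ rfl)
  by_cases h2 : g = τ.inv f
  · subst h2
    exact Or.inl (τ.flagPartition_inv f).symm
  right
  have key : ∀ f g : τ.Fl, τ.inv f ≠ f → τ.inv g ≠ g → g ≠ f → g ≠ τ.inv f →
      τ.bd g ∈ τ.vertexSide f → τ.bd f ∈ τ.vertexSide g →
      τ.flagSide (τ.inv f) ∩ τ.flagSide (τ.inv g) = ∅ := by
    intro f g hf hg h1 h2 hgf hfg
    have hfg' : f ≠ τ.inv g := fun h => h2 (by rw [h, τ.inv_inv])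
    have hsub := τ.vertexSide_inv_subset hf hgf (τ.bd_inv_mem_vertexSide h1 h2 hgf)
      (τ.bd_inv_mem_vertexSide (Ne.symm h1) hfg' hfg)
    refine Set.eq_empty_iff_forall_notMem.2 fun s hs => ?_
    exact Set.disjoint_left.1 (τ.disjoint_vertexSide hg) (hsub hs.1) hs.2
  have key' : ∀ f g : τ.Fl, τ.inv f ≠ f → τ.inv g ≠ g → g ≠ f → g ≠ τ.inv f →
      τ.bd g ∈ τ.vertexSide f →
      ∃ A ∈ τ.flagPartition f, ∃ C ∈ τ.flagPartition g, A ∩ C = ∅ := by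
    intro f g hf hg h1 h2 hgf
    rcases τ.mem_vertexSide_or g (τ.bd f) with h | h
    · exact ⟨_, Or.inr rfl, _, Or.inr rfl, key f g hf hg h1 h2 hgf h⟩
    · refine ⟨_, Or.inr rfl, _, Or.inl (congrArg _ (τ.inv_inv g)),
        key f (τ.inv g) hf (τ.inv_ne_inv hg) ?_ ?_ (τ.bd_inv_mem_vertexSide h1 h2 hgf) h⟩
      · exact fun h' => h2 (by rw [← h', τ.inv_inv])
      · exact fun h' => h1 (by rw [← τ.inv_inv g, h', τ.inv_inv])
  rcases τ.mem_vertexSide_or f (τ.bd g) with h | h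
  · exact key' f g hf hg h1 h2 h
  · rw [← τ.flagPartition_inv f]
    exact key' (τ.inv f) g (τ.inv_ne_inv hf) hg h2 (by rwa [τ.inv_inv]) h

/-- Each side of an edge contains an end vertex. -/
theorem exists_end_mem_vertexSide {f : τ.Fl} (hf : τ.inv f ≠ f) :
    ∃ v ∈ τ.vertexSide f, Nat.card {g : τ.Fl // τ.bd g = v ∧ τ.inv g ≠ g} ≤ 1 := by
  obtain ⟨h, ⟨hh, hsub⟩, hmin⟩ := Set.exists_min_image
    {h : τ.Fl | τ.inv h ≠ h ∧ τ.vertexSide h ⊆ τ.vertexSide f}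
    (fun h => (τ.vertexSide h).ncard) (Set.toFinite _) ⟨f, hf, subset_rfl⟩
  refine ⟨τ.bd h, hsub (τ.bd_mem_vertexSide h), ?_⟩
  have huniq : ∀ g, τ.bd g = τ.bd h → τ.inv g ≠ g → g = h := by
    intro g hgb hg
    by_contra hne
    have hloop : g ≠ τ.inv h := by
      rintro rfl
      exact τ.not_reflTransGen_sideAdj hh (hgb ▸ Relation.ReflTransGen.refl)
    have hne' : h ≠ τ.inv g := fun h' => hloop (by rw [h', τ.inv_inv])
    have hmem : τ.bd h ∈ τ.vertexSide g := hgb ▸ τ.bd_mem_vertexSide g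
    have hss := τ.vertexSide_inv_subset hg hmem
      (τ.bd_inv_mem_vertexSide (Ne.symm hne) hne' hmem)
      (τ.bd_inv_mem_vertexSide hne hloop (hgb ▸ τ.bd_mem_vertexSide h))
    have hlt : (τ.vertexSide (τ.inv g)).ncard < (τ.vertexSide h).ncard :=
      Set.ncard_lt_ncard ⟨hss, fun h' => Set.disjoint_left.1 (τ.disjoint_vertexSide hg) hmem
        (h' (τ.bd_mem_vertexSide h))⟩
    exact absurd (hmin (τ.inv g) ⟨τ.inv_ne_inv hg, hss.trans hsub⟩) (not_le.2 hlt)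
  have : Subsingleton {g : τ.Fl // τ.bd g = τ.bd h ∧ τ.inv g ≠ g} :=
    ⟨fun a b => Subtype.ext ((huniq _ a.2.1 a.2.2).trans (huniq _ b.2.1 b.2.2).symm)⟩
  exact Finite.card_le_one_iff_subsingleton.2 this

variable [Finite γ] {W : Set γ}

theorem PaintedStable.flagSide_stable (hτ : τ.PaintedStable W) {f : τ.Fl} (hf : τ.inv f ≠ f) :
    (τ.flagSide f ∩ W).Nonempty ∧ 2 ≤ (τ.flagSide f).ncard := by
  obtain ⟨v, hv, hend⟩ := τ.exists_end_mem_vertexSide hf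
  obtain ⟨s, hsW, hs⟩ := hτ.2 v hend
  refine ⟨⟨s, τ.mem_flagSide.2 (hs ▸ hv), hsW⟩, ?_⟩
  have hcover : {g | τ.bd g = v} ⊆
      {g | τ.bd g = v ∧ τ.inv g ≠ g} ∪ τ.label '' τ.flagSide f := by
    intro g hg
    by_cases hfix : τ.inv g = g
    · obtain ⟨s, rfl⟩ := τ.label_surj g hfix
      exact Or.inr ⟨s, τ.mem_flagSide.2 (hg.symm ▸ hv), rfl⟩
    · exact Or.inl ⟨hg, hfix⟩
  have h1 := Set.ncard_le_ncard hcover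
  have h2 := Set.ncard_union_le {g | τ.bd g = v ∧ τ.inv g ≠ g} (τ.label '' τ.flagSide f)
  have h3 : (τ.label '' τ.flagSide f).ncard ≤ (τ.flagSide f).ncard := Set.ncard_image_le
  have h4 : 3 ≤ {g | τ.bd g = v}.ncard := hτ.1 v
  have h5 : {g | τ.bd g = v ∧ τ.inv g ≠ g}.ncard ≤ 1 := hend
  omega

theorem PaintedStable.flagPartition_stable (hτ : τ.PaintedStable W) {f : τ.Fl}
    (hf : τ.inv f ≠ f) : PaintedStablePart W (τ.flagPartition f) := by
  have h1 := PaintedStable.flagSide_stable τ hτ hf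
  have h2 := PaintedStable.flagSide_stable τ hτ (τ.inv_ne_inv hf)
  refine ⟨isTwoPartition_pair h1.1.left h2.1.left ?_ ?_, ?_⟩
  · exact Set.disjoint_left.2 fun s hs hs' =>
      Set.disjoint_left.1 (τ.disjoint_vertexSide hf) hs hs'
  · exact Set.eq_univ_of_forall fun s => τ.mem_vertexSide_or f _
  · rintro A (rfl | rfl)
    exacts [h1, h2]

theorem PaintedStable.goodFamily_edgeFamily (hτ : τ.PaintedStable W) :
    GoodFamily W τ.edgeFamily := by
  refine ⟨?_, ?_⟩
  · rintro _ ⟨f, hf, rfl⟩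
    exact PaintedStable.flagPartition_stable τ hτ hf
  · rintro _ ⟨f, hf, rfl⟩ _ ⟨g, hg, rfl⟩ hne
    obtain ⟨A, hA, C, hC, h⟩ := (τ.flagPartition_eq_or_inter_eq_empty hf hg).resolve_left hne
    exact delta_eq_one_of_inter_eq_empty (PaintedStable.flagPartition_stable τ hτ hf).1
      (PaintedStable.flagPartition_stable τ hτ hg).1 hne hA hC h

end LTree

/-- For a painted stable `S`-tree `τ` and a painted stable 2-partition
`σ` of `S`, exactly one of the following holds: (i) `σ` is the partition of some edge
of `τ`; (ii) `σ` is not an edge partition but `{σ_e} ∪ {σ}` is a good family (`σ`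
breaks `τ` at a vertex); (iii) `δ(σ, σ_e) = 2` for some edge `e` (`σ` does not break
`τ`). -/
theorem breaks_trichotomy {γ : Type} [Finite γ] (W : Set γ)
    (τ : LTree γ) (hτ : τ.PaintedStable W)
    (σ : Set (Set γ)) (hσ : PaintedStablePart W σ) :
    (σ ∈ τ.edgeFamily ∧
      ¬(σ ∉ τ.edgeFamily ∧ GoodFamily W (τ.edgeFamily ∪ {σ})) ∧
      ¬(∃ f, τ.inv f ≠ f ∧ delta σ (τ.flagPartition f) = 2)) ∨
    (¬(σ ∈ τ.edgeFamily) ∧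
      (σ ∉ τ.edgeFamily ∧ GoodFamily W (τ.edgeFamily ∪ {σ})) ∧
      ¬(∃ f, τ.inv f ≠ f ∧ delta σ (τ.flagPartition f) = 2)) ∨
    (¬(σ ∈ τ.edgeFamily) ∧
      ¬(σ ∉ τ.edgeFamily ∧ GoodFamily W (τ.edgeFamily ∪ {σ})) ∧
      (∃ f, τ.inv f ≠ f ∧ delta σ (τ.flagPartition f) = 2)) := by
  have hgood := LTree.PaintedStable.goodFamily_edgeFamily τ hτ
  by_cases hmem : σ ∈ τ.edgeFamily
  · refine Or.inl ⟨hmem, fun h => h.1 hmem, ?_⟩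
    rintro ⟨f, hf, hδ⟩
    by_cases heq : σ = τ.flagPartition f
    · have := delta_self_le hσ.1
      rw [← heq] at hδ
      omega
    · have := hgood.2 σ hmem _ ⟨f, hf, rfl⟩ heq
      omega
  have hne : ∀ ρ ∈ τ.edgeFamily, σ ≠ ρ := fun ρ hρ h => hmem (h ▸ hρ)
  by_cases hδ : ∃ f, τ.inv f ≠ f ∧ delta σ (τ.flagPartition f) = 2
  · refine Or.inr (Or.inr ⟨hmem, ?_, hδ⟩)
    rintro ⟨-, hg⟩
    obtain ⟨f, hf, hδ⟩ := hδ
    have := hg.2 σ (Or.inr rfl) _ (Or.inl ⟨f, hf, rfl⟩) (hne _ ⟨f, hf, rfl⟩)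
    omega
  · have hone : ∀ ρ ∈ τ.edgeFamily, delta σ ρ = 1 := by
      intro ρ hρ
      refine (delta_eq_one_or_two hσ.1 (hgood.1 ρ hρ).1 (hne ρ hρ)).resolve_right fun h => hδ ?_
      obtain ⟨f, hf, rfl⟩ := hρ
      exact ⟨f, hf, h⟩
    refine Or.inr (Or.inl ⟨hmem, ⟨hmem, ?_, ?_⟩, hδ⟩)
    · rintro ρ (hρ | rfl)
      exacts [hgood.1 ρ hρ, hσ]
    · rintro ρ (hρ | rfl) ρ' (hρ' | rfl) hρρ
      · exact hgood.2 ρ hρ ρ' hρ' hρρ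
      · rw [delta_comm]
        exact hone ρ hρ
      · exact hone ρ' hρ'
      · exact absurd rfl hρρ

end EMO
end
end

section
/- Let τ be a painted stable S-tree and σ a painted stable 2-partition of S such that δ(σ, σ_e) = 2 for some edge e of τ. Then l_σ · m(τ) ∈ I_S. -/
open scoped Classical
noncomputable section

namespace EMO

/-- A nonempty set has an element that is white as soon as the set has a white element. -/
theorem exists_mem_white_of_nonempty {γ : Type*} (W : Set γ) {X : Set γ} (hX : X.Nonempty) :
    ∃ x ∈ X, ∀ y ∈ X, y ∈ W → x ∈ W := by
  by_cases h : (X ∩ W).Nonempty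
  · obtain ⟨x, hx, hxW⟩ := h
    exact ⟨x, hx, fun _ _ _ => hxW⟩
  · obtain ⟨x, hx⟩ := hX
    exact ⟨x, hx, fun y hy hyW => (h ⟨y, hy, hyW⟩).elim⟩

/-- If `δ = 2` then all four intersections of the parts are nonempty. -/
theorem inter_nonempty_of_delta_eq_two {γ : Type*} {A B C D : Set γ}
    (h : delta {A, B} {C, D} = 2) :
    (A ∩ C).Nonempty ∧ (A ∩ D).Nonempty ∧ (B ∩ C).Nonempty ∧ (B ∩ D).Nonempty := by
  have not_three : ∀ X Y Z : Set γ,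
      ¬ {S : Set γ | S.Nonempty ∧ ∃ P ∈ ({A, B} : Set (Set γ)), ∃ Q ∈ ({C, D} : Set (Set γ)),
        S = P ∩ Q} ⊆ {X, Y, Z} := by
    intro X Y Z hsub
    have hle := Set.ncard_le_ncard hsub (Set.toFinite _)
    have h1 := Set.ncard_insert_le X {Y, Z}
    have h2 := Set.ncard_insert_le Y {Z}
    rw [Set.ncard_singleton] at h2
    unfold delta at h
    omega
  refine ⟨?_, ?_, ?_, ?_⟩ <;> by_contra hne
  · refine not_three (A ∩ D) (B ∩ C) (B ∩ D) ?_
    rintro S ⟨hS, P, rfl | rfl, Q, rfl | rfl, rfl⟩ <;> simp_all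
  · refine not_three (A ∩ C) (B ∩ C) (B ∩ D) ?_
    rintro S ⟨hS, P, rfl | rfl, Q, rfl | rfl, rfl⟩ <;> simp_all
  · refine not_three (A ∩ C) (A ∩ D) (B ∩ D) ?_
    rintro S ⟨hS, P, rfl | rfl, Q, rfl | rfl, rfl⟩ <;> simp_all
  · refine not_three (A ∩ C) (A ∩ D) (B ∩ C) ?_
    rintro S ⟨hS, P, rfl | rfl, Q, rfl | rfl, rfl⟩ <;> simp_all

/-- Painted stable 2-partitions with `δ = 2` are separated by an allowed quadruple. -/
theorem PaintedStablePart.exists_allowed_of_delta_eq_two {γ : Type*} {W : Set γ}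
    {σ ρ : Set (Set γ)} (hσ : PaintedStablePart W σ) (hρ : PaintedStablePart W ρ)
    (h : delta σ ρ = 2) :
    ∃ i j a b : γ, Allowed W i j a b ∧ SplitsPair σ i j a b ∧ SplitsPair ρ a j i b := by
  obtain ⟨⟨A, B, rfl, hAB, -, -, dAB, uAB⟩, hσW⟩ := hσ
  obtain ⟨⟨C, D, rfl, hCD, -, -, dCD, uCD⟩, hρW⟩ := hρ
  obtain ⟨nAC, nAD, nBC, nBD⟩ := inter_nonempty_of_delta_eq_two h
  obtain ⟨i, ⟨iA, iD⟩, hi⟩ := exists_mem_white_of_nonempty W nAD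
  obtain ⟨j, ⟨jA, jC⟩, hj⟩ := exists_mem_white_of_nonempty W nAC
  obtain ⟨a, ⟨aB, aC⟩, ha⟩ := exists_mem_white_of_nonempty W nBC
  obtain ⟨b, ⟨bB, bD⟩, hb⟩ := exists_mem_white_of_nonempty W nBD
  have memAB : ∀ x, x ∈ A ∨ x ∈ B := fun x => (Set.ext_iff.1 uAB x).2 trivial
  have memCD : ∀ x, x ∈ C ∨ x ∈ D := fun x => (Set.ext_iff.1 uCD x).2 trivial
  have neAB : ∀ x ∈ A, ∀ y ∈ B, x ≠ y := fun x hx y hy => dAB.ne_of_mem hx hy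
  have neCD : ∀ x ∈ C, ∀ y ∈ D, x ≠ y := fun x hx y hy => dCD.ne_of_mem hx hy
  obtain ⟨wA, hwA, wAW⟩ := (hσW A (by simp)).1
  obtain ⟨wB, hwB, wBW⟩ := (hσW B (by simp)).1
  obtain ⟨wC, hwC, wCW⟩ := (hρW C (by simp)).1
  obtain ⟨wD, hwD, wDW⟩ := (hρW D (by simp)).1
  refine ⟨i, j, a, b, ⟨(neCD j jC i iD).symm, neAB i iA a aB, neAB i iA b bB, neAB j jA a aB,
    neAB j jA b bB, neCD a aC b bD, ?_, ?_, ?_, ?_⟩,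
    ⟨A, by simp, B, by simp, hAB, iA, jA, aB, bB⟩, ⟨C, by simp, D, by simp, hCD, aC, jC, iD, bD⟩⟩
  · exact (memCD wA).elim (fun hC => .inr (hj wA ⟨hwA, hC⟩ wAW))
      fun hD => .inl (hi wA ⟨hwA, hD⟩ wAW)
  · exact (memCD wB).elim (fun hC => .inl (ha wB ⟨hwB, hC⟩ wBW))
      fun hD => .inr (hb wB ⟨hwB, hD⟩ wBW)
  · exact (memAB wC).elim (fun hA => .inr (hj wC ⟨hA, hwC⟩ wCW))
      fun hB => .inl (ha wC ⟨hB, hwC⟩ wCW)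
  · exact (memAB wD).elim (fun hA => .inl (hi wD ⟨hA, hwD⟩ wDW))
      fun hB => .inr (hb wD ⟨hB, hwD⟩ wDW)

theorem X_mul_lvar_mem_idealI {γ : Type} {W : Set γ} {k : Type} [CommRing k]
    {σ ρ : Set (Set γ)} (hσ : PaintedStablePart W σ) (h : delta σ ρ = 2) :
    MvPolynomial.X (⟨σ, hσ⟩ : PSP γ W) * lvar γ W k ρ ∈ idealI γ W k := by
  by_cases hρ : PaintedStablePart W ρ
  · rw [lvar, dif_pos hρ]
    exact Ideal.subset_span
      (.inr ⟨⟨σ, hσ⟩, ⟨ρ, hρ⟩, hσ.exists_allowed_of_delta_eq_two hρ h, rfl⟩)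
  · rw [lvar, dif_neg hρ, mul_zero]
    exact zero_mem _

theorem lvar_dvd_mFam {γ : Type} [Finite γ] (W : Set γ) (k : Type) [CommRing k]
    {E : Set (Set (Set γ))} {ρ : Set (Set γ)} (hρ : ρ ∈ E) :
    lvar γ W k ρ ∣ mFam γ W k E := by
  rw [mFam, finprod_mem_eq_finite_toFinset_prod _ (Set.toFinite E)]
  exact Finset.dvd_prod_of_mem _ ((Set.toFinite E).mem_toFinset.2 hρ)

/-- If `σ` is a painted stable 2-partition with `δ(σ, σ_e) = 2` for
some edge `e` of the painted stable `S`-tree `τ` (i.e. `σ` does not break `τ`), then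
`l_σ · m(τ) ∈ I_S`. -/
theorem lvar_mul_goodMonomial_mem_idealI {γ : Type} [Finite γ] (W : Set γ)
    (k : Type) [CommRing k]
    (h3 : 3 ≤ Nat.card γ) (hW : 2 ≤ W.ncard)
    (τ : LTree γ) (hτ : τ.PaintedStable W)
    (σ : Set (Set γ)) (hσ : PaintedStablePart W σ)
    (hnb : ∃ f, τ.inv f ≠ f ∧ delta σ (τ.flagPartition f) = 2) :
    MvPolynomial.X (⟨σ, hσ⟩ : PSP γ W) * mFam γ W k τ.edgeFamily ∈ idealI γ W k := by
  obtain ⟨f, hf, hδ⟩ := hnb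
  exact Ideal.mem_of_dvd _ (mul_dvd_mul_left _ (lvar_dvd_mFam W k ⟨f, hf, rfl⟩))
    (X_mul_lvar_mem_idealI hσ hδ)

end EMO
end
end
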